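/- arXiv:2504.10516 — 2 statements merged into one kernel-verified Lean document; each statement's English description precedes it below -/
import Mathlib

section
/- For any odd integer d ≥ 3 and any r = (a₁^r, a₂^r), w = (a₁^w, a₂^w), v = (a₁^v, a₂^v) in (ZMod d)², the trace of the triple product of phase-space point operators equals Tr[A^r A^w A^v] = exp((4πi/d)·f), where f = a₁^r(a₂^v − a₂^w) + a₁^w(a₂^r − a₂^v) + a₁^v(a₂^w − a₂^r), computed with any integer representatives (well defined since exp(4πi) = 1). -/
open Matrix

noncomputable section

/-- ω = exp(2πi/d). -/
def wUnit (d : ℕ) : ℂ := Complex.exp (2 * (Real.pi : ℂ) * Complex.I / d)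

/-- τ = exp((d+1)πi/d). -/
def tUnit (d : ℕ) : ℂ := Complex.exp (((d : ℂ) + 1) * (Real.pi : ℂ) * Complex.I / d)

/-- The shift operator, X|k⟩ = |k+1⟩. -/
def shiftX (d : ℕ) : Matrix (ZMod d) (ZMod d) ℂ :=
  Matrix.of fun i j => if i = j + 1 then 1 else 0

/-- The clock operator, Z|k⟩ = ω^k |k⟩. -/
def clockZ (d : ℕ) : Matrix (ZMod d) (ZMod d) ℂ :=
  Matrix.of fun i j => if i = j then wUnit d ^ j.val else 0

/-- The Heisenberg-Weyl operator T_u = τ^{-a₁a₂} Z^{a₁} X^{a₂}. -/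
def HW (d : ℕ) [NeZero d] (u : ZMod d × ZMod d) : Matrix (ZMod d) (ZMod d) ℂ :=
  tUnit d ^ (-(u.1 * u.2)).val • (clockZ d ^ (u.1).val * shiftX d ^ (u.2).val)

/-- The phase space point operator at the origin, A^0 = (1/d) Σ_u T_u. -/
def A0 (d : ℕ) [NeZero d] : Matrix (ZMod d) (ZMod d) ℂ :=
  (1 / (d : ℂ)) • ∑ u : ZMod d × ZMod d, HW d u

/-- The phase space point operator A^u = T_u A^0 (T_u)†. -/
def Apt (d : ℕ) [NeZero d] (u : ZMod d × ZMod d) : Matrix (ZMod d) (ZMod d) ℂ :=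
  HW d u * A0 d * (HW d u)ᴴ

/-- Modulo an odd `d`, `(d + 1) / 2` is the inverse of two. -/
lemma two_mul_half_succ {d : ℕ} (hodd : Odd d) :
    (2 : ZMod d) * (((d + 1) / 2 : ℕ) : ZMod d) = 1 := by
  obtain ⟨m, rfl⟩ := hodd
  have h : 2 * ((2 * m + 1 + 1) / 2) = (2 * m + 1) + 1 := by omega
  have := congrArg (Nat.cast : ℕ → ZMod (2 * m + 1)) h
  rw [Nat.cast_mul, Nat.cast_add, ZMod.natCast_self] at this
  simpa using this

lemma wUnit_eq_stdAddChar (d : ℕ) [NeZero d] : wUnit d = ZMod.stdAddChar (1 : ZMod d) := by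
  have := ZMod.stdAddChar_coe (N := d) 1
  simp only [Int.cast_one, mul_one] at this
  rw [this, wUnit]

lemma wUnit_pow_val {d : ℕ} [NeZero d] (k : ZMod d) :
    wUnit d ^ k.val = ZMod.stdAddChar k := by
  rw [wUnit_eq_stdAddChar, ← AddChar.map_nsmul_eq_pow, nsmul_eq_mul, mul_one, ZMod.natCast_zmod_val]

lemma tUnit_eq_wUnit_pow {d : ℕ} (hodd : Odd d) : tUnit d = wUnit d ^ ((d + 1) / 2) := by
  obtain ⟨m, rfl⟩ := hodd
  have h : (2 * m + 1 + 1) / 2 = m + 1 := by omega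
  rw [h, tUnit, wUnit, ← Complex.exp_nat_mul]
  congr 1
  push_cast
  ring

lemma tUnit_pow_val {d : ℕ} [NeZero d] (hodd : Odd d) (k : ZMod d) :
    tUnit d ^ k.val = ZMod.stdAddChar ((((d + 1) / 2 : ℕ) : ZMod d) * k) := by
  rw [tUnit_eq_wUnit_pow hodd, pow_right_comm, wUnit_pow_val, ← AddChar.map_nsmul_eq_pow,
    nsmul_eq_mul]

lemma shiftX_pow_apply {d : ℕ} [NeZero d] (n : ℕ) (i j : ZMod d) :
    (shiftX d ^ n) i j = if i = j + n then 1 else 0 := by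
  induction n generalizing i j with
  | zero => simp [Matrix.one_apply]
  | succ n ih =>
    rw [pow_succ, Matrix.mul_apply]
    simp only [ih]
    simp [shiftX, add_assoc, add_comm (n : ZMod d) 1]

lemma clockZ_pow {d : ℕ} [NeZero d] (n : ℕ) :
    clockZ d ^ n = Matrix.diagonal fun k => ZMod.stdAddChar ((n : ZMod d) * k) := by
  have h : clockZ d = Matrix.diagonal fun k => ZMod.stdAddChar (k : ZMod d) := by
    ext i j
    simp only [clockZ, Matrix.of_apply, wUnit_pow_val, Matrix.diagonal_apply]
    split_ifs with h <;> simp [h]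
  rw [h, Matrix.diagonal_pow]
  congr 1
  ext k
  rw [Pi.pow_apply, ← AddChar.map_nsmul_eq_pow, nsmul_eq_mul]

/-- Left multiplication by a matrix with a single nonzero entry in each row. -/
lemma mul_apply_of_row_eq_ite {n R : Type*} [Fintype n] [DecidableEq n] 
    [NonUnitalNonAssocSemiring R]
    {M : Matrix n n R} {σ : n → n} {c : n → R} (hM : ∀ i j, M i j = if j = σ i then c i else 0)
    (N : Matrix n n R) (i j : n) : (M * N) i j = c i * N (σ i) j := by
  simp [Matrix.mul_apply, hM]

lemma HW_apply {d : ℕ} [NeZero d] (hodd : Odd d) (u : ZMod d × ZMod d) (i j : ZMod d) :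
    HW d u i j = if j = i - u.2 then
      ZMod.stdAddChar (u.1 * i - (((d + 1) / 2 : ℕ) : ZMod d) * (u.1 * u.2)) else 0 := by
  simp only [HW, clockZ_pow, Matrix.smul_apply, Matrix.diagonal_mul, shiftX_pow_apply,
    ZMod.natCast_zmod_val, tUnit_pow_val hodd, smul_eq_mul, eq_sub_iff_add_eq, eq_comm (a := i)]
  split_ifs
  · rw [mul_one, ← AddChar.map_add_eq_mul]
    congr 1
    ring
  · simp

/-- The phase-space point operator at the origin is the parity operator. -/
lemma A0_apply {d : ℕ} [NeZero d] (hodd : Odd d) (i j : ZMod d) :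
    A0 d i j = if j = -i then 1 else 0 := by
  have h2 := two_mul_half_succ hodd
  set h : ZMod d := (((d + 1) / 2 : ℕ) : ZMod d) with hh
  have hiff : i - h * (i - j) = 0 ↔ j = -i := by
    constructor
    · intro e
      linear_combination 2 * e + (i - j) * h2
    · rintro rfl
      linear_combination -i * h2
  have hsum : ∀ a : ZMod d, ∑ b : ZMod d, HW d (a, b) i j =
      ZMod.stdAddChar (a * (i - h * (i - j))) := by
    intro a
    simp only [HW_apply hodd, ← hh]
    rw [Finset.sum_eq_single (i - j)]
    · rw [if_pos (by ring)]
      congr 1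
      ring
    · intro b _ hb
      exact if_neg fun e => hb (by rw [e]; ring)
    · simp
  have hd : (d : ℂ) ≠ 0 := Nat.cast_ne_zero.mpr (NeZero.ne d)
  rw [A0, Matrix.smul_apply, Matrix.sum_apply, Fintype.sum_prod_type]
  simp only [hsum, AddChar.sum_mulShift _ (ZMod.isPrimitive_stdAddChar d), hiff, ZMod.card]
  split_ifs <;> simp [hd]

lemma Apt_apply {d : ℕ} [NeZero d] (hodd : Odd d) (u : ZMod d × ZMod d) (i j : ZMod d) :
    Apt d u i j =
      if j = 2 * u.2 - i then ZMod.stdAddChar (u.1 * (2 * (i - u.2))) else 0 := by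
  have hiff : -(i - u.2) = j - u.2 ↔ j = 2 * u.2 - i := by
    constructor <;> intro e <;> linear_combination -e
  rw [Apt, Matrix.mul_assoc, mul_apply_of_row_eq_ite (HW_apply hodd u),
    mul_apply_of_row_eq_ite (A0_apply hodd), Matrix.conjTranspose_apply, HW_apply hodd, one_mul]
  simp only [hiff]
  split_ifs with e
  · rw [← starRingEnd_apply, ← AddChar.map_neg_eq_conj, ← AddChar.map_add_eq_mul, e]
    congr 1
    ring
  · simp

/-- Trace of a triple product of phase-space point operators:
Tr[A^r A^w A^v] = exp((4πi/d)·f) with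
f = a₁^r(a₂^v − a₂^w) + a₁^w(a₂^r − a₂^v) + a₁^v(a₂^w − a₂^r). -/
theorem trace_triple_product_phase_space_point_operators
    (d : ℕ) [NeZero d] (hd : 3 ≤ d) (hodd : Odd d) (r w v : ZMod d × ZMod d) :
    (Apt d r * Apt d w * Apt d v).trace =
      Complex.exp (4 * (Real.pi : ℂ) * Complex.I / d *
        (((r.1 * (v.2 - w.2) + w.1 * (r.2 - v.2) + v.1 * (w.2 - r.2)).val : ℕ) : ℂ)) := by
  have h2 := two_mul_half_succ hodd
  set f : ZMod d := r.1 * (v.2 - w.2) + w.1 * (r.2 - v.2) + v.1 * (w.2 - r.2) with hf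
  have hexp : Complex.exp (4 * (Real.pi : ℂ) * Complex.I / d * (f.val : ℂ)) =
      ZMod.stdAddChar (2 * f) := by
    rw [two_mul, AddChar.map_add_eq_mul, ← wUnit_pow_val, wUnit, ← Complex.exp_nat_mul,
      ← Complex.exp_add]
    congr 1
    ring
  have hiff : ∀ i : ZMod d,
      i = 2 * v.2 - (2 * w.2 - (2 * r.2 - i)) ↔ i = r.2 - w.2 + v.2 := by
    intro i
    constructor
    · intro e
      linear_combination (((d + 1) / 2 : ℕ) : ZMod d) * e - (i - r.2 + w.2 - v.2) * h2
    · rintro rfl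
      ring
  rw [hexp]
  simp only [Matrix.trace, Matrix.diag_apply, Matrix.mul_assoc,
    mul_apply_of_row_eq_ite (Apt_apply hodd _), Apt_apply hodd, hiff, mul_ite, mul_zero,
    Finset.sum_ite_eq', Finset.mem_univ, if_true, ← AddChar.map_add_eq_mul]
  congr 1
  rw [hf]
  ring
end
end

section
/- For every integer d ≥ 2 and every real δ, the operator λ₀·R^{T₃} − Q^{T₃} on (ℂ^d)^{⊗3} equals the linear combination c_I·I + c₁₂·P((12))^{T₃} + c₁₃·(P((13))^{T₃} + P((23))^{T₃}) + c₁₂₃·(P((123))^{T₃} + P((132))^{T₃}), with coefficients c_I = (λ₀·d(2δ−δ²) − δ²)/d³ − (1−δ)δ/(d·D(2,d)) + λ₀(1−δ)²/(2·D(2,d)) − (1−δ)²/(6·D(3,d)), c₁₂ = λ₀(1−δ)²/(2·D(2,d)) − (1−δ)²/(6·D(3,d)), c₁₃ = −((1−δ)²/(6·D(3,d)) + (1−δ)δ/(2d·D(2,d))), and c₁₂₃ = −(1−δ)²/(6·D(3,d)). -/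
open Matrix

noncomputable section

/-- Index type for (ℂ^d)^{⊗3}. -/
abbrev Idx (d : ℕ) := Fin 3 → Fin d

/-- The operator on (ℂ^d)^{⊗3} permuting the tensor factors according to c ∈ S₃:
P(c)(v₁⊗v₂⊗v₃) = v_{c⁻¹(1)}⊗v_{c⁻¹(2)}⊗v_{c⁻¹(3)}. -/
def Perm3 (d : ℕ) (c : Equiv.Perm (Fin 3)) : Matrix (Idx d) (Idx d) ℂ :=
  Matrix.of fun i j => if ∀ k, i k = j (c⁻¹ k) then 1 else 0

/-- The projector onto the symmetric subspace of (ℂ^d)^{⊗3}. -/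
def projSym3 (d : ℕ) : Matrix (Idx d) (Idx d) ℂ :=
  ((6 : ℂ))⁻¹ • ∑ c : Equiv.Perm (Fin 3), Perm3 d c

/-- The depolarizing map 𝒟_δ applied to tensor factor s of an operator on (ℂ^d)^{⊗3}. -/
def depOn (d : ℕ) (δ : ℝ) (s : Fin 3) (M : Matrix (Idx d) (Idx d) ℂ) :
    Matrix (Idx d) (Idx d) ℂ :=
  Matrix.of fun i j => (1 - (δ : ℂ)) * M i j +
    ((δ : ℂ) / d) *
      (if i s = j s then ∑ k : Fin d, M (Function.update i s k) (Function.update j s k) else 0)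

/-- D(n,d) = binom(n+d−1, n), the dimension of the symmetric subspace. -/
def Dnd (n d : ℕ) : ℕ := Nat.choose (n + d - 1) n

/-- Q = (𝒟_δ⊗𝒟_δ⊗id)(Π₃)/D(3,d). -/
def Qop (d : ℕ) (δ : ℝ) : Matrix (Idx d) (Idx d) ℂ :=
  ((Dnd 3 d : ℂ))⁻¹ • depOn d δ 0 (depOn d δ 1 (projSym3 d))

/-- R = ((𝒟_δ⊗𝒟_δ)(Π₂)/D(2,d)) ⊗ I_d, using Π₂ ⊗ I = (I + P((12)))/2 on (ℂ^d)^{⊗3}. -/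
def Rop (d : ℕ) (δ : ℝ) : Matrix (Idx d) (Idx d) ℂ :=
  ((Dnd 2 d : ℂ))⁻¹ •
    depOn d δ 0 (depOn d δ 1 (((2 : ℂ))⁻¹ • (1 + Perm3 d (Equiv.swap 0 1))))

/-- The partial transpose on the third tensor factor:
(M^{T₃})_{(i₁i₂i₃),(j₁j₂j₃)} = M_{(i₁i₂j₃),(j₁j₂i₃)}. -/
def pt3 (d : ℕ) (M : Matrix (Idx d) (Idx d) ℂ) : Matrix (Idx d) (Idx d) ℂ :=
  Matrix.of fun i j => M (Function.update i 2 (j 2)) (Function.update j 2 (i 2))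

theorem Perm3_one (d : ℕ) : Perm3 d 1 = 1 := by
  ext i j
  simp [Perm3, Matrix.one_apply, funext_iff]

theorem depOn_add (d : ℕ) (δ : ℝ) (s : Fin 3) (M N : Matrix (Idx d) (Idx d) ℂ) :
    depOn d δ s (M + N) = depOn d δ s M + depOn d δ s N := by
  ext i j
  simp only [depOn, Matrix.of_apply, Matrix.add_apply, Finset.sum_add_distrib]
  split_ifs <;> ring

theorem depOn_smul (d : ℕ) (δ : ℝ) (s : Fin 3) (a : ℂ) (M : Matrix (Idx d) (Idx d) ℂ) :
    depOn d δ s (a • M) = a • depOn d δ s M := by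
  ext i j
  simp only [depOn, Matrix.of_apply, Matrix.smul_apply, smul_eq_mul, ← Finset.mul_sum]
  split_ifs <;> ring

theorem depOn_Perm3_of_fixed {d : ℕ} (hd : d ≠ 0) (δ : ℝ) {s : Fin 3}
    {c : Equiv.Perm (Fin 3)} (hc : c s = s) :
    depOn d δ s (Perm3 d c) = Perm3 d c := by
  have hd' : (d : ℂ) ≠ 0 := Nat.cast_ne_zero.mpr hd
  have hs : c⁻¹ s = s := Equiv.Perm.inv_eq_iff_eq.mpr hc.symm
  ext i j
  have key : ∀ k, (∀ m, Function.update i s k m = Function.update j s k (c⁻¹ m)) ↔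
      ∀ m, m ≠ s → i m = j (c⁻¹ m) := by
    intro k
    refine forall_congr' fun m => ?_
    by_cases hm : m = s
    · subst hm
      simp [hs]
    · have : c⁻¹ m ≠ s := fun h => hm ((Equiv.Perm.inv_eq_iff_eq.mp h).trans hc)
      rw [Function.update_of_ne hm, Function.update_of_ne this]
      simp only [ne_eq, hm, not_false_eq_true, forall_const]
  have split : (∀ m, i m = j (c⁻¹ m)) ↔ i s = j s ∧ ∀ m, m ≠ s → i m = j (c⁻¹ m) := by
    refine ⟨fun h => ⟨by simpa [hs] using h s, fun m _ => h m⟩, fun h m => ?_⟩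
    by_cases hm : m = s
    · subst hm
      simpa [hs] using h.1
    · exact h.2 m hm
  simp only [depOn, Perm3, Matrix.of_apply, key, split]
  by_cases h1 : i s = j s
  · simp only [h1, true_and, Finset.sum_const, Finset.card_univ, Fintype.card_fin,
      nsmul_eq_mul]
    field_simp
    split_ifs <;> ring
  · simp only [h1, false_and, if_false]
    ring

theorem depOn_Perm3_of_moved (d : ℕ) (δ : ℝ) {s : Fin 3}
    {c : Equiv.Perm (Fin 3)} (hc : c s ≠ s) :
    depOn d δ s (Perm3 d c) =
      (1 - (δ : ℂ)) • Perm3 d c + ((δ : ℂ) / d) • Perm3 d (Equiv.swap s (c s) * c) := by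
  have hs : c⁻¹ s ≠ s := fun h => hc (Equiv.Perm.inv_eq_iff_eq.mp h).symm
  have hcs : c⁻¹ (c s) = s := c.symm_apply_apply s
  ext i j
  have key : ∀ k, (∀ m, Function.update i s k m = Function.update j s k (c⁻¹ m)) ↔
      k = j (c⁻¹ s) ∧ i (c s) = j (c⁻¹ s) ∧ ∀ m, m ≠ s → m ≠ c s → i m = j (c⁻¹ m) := by
    intro k
    constructor
    · intro h
      have h1 : k = j (c⁻¹ s) := by
        simpa only [Function.update_self, Function.update_of_ne hs] using h s
      refine ⟨h1, ?_, fun m hm hm' => ?_⟩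
      · simpa only [Function.update_of_ne hc, hcs, Function.update_self,
          ← h1] using h (c s)
      have : c⁻¹ m ≠ s := fun h => hm' (Equiv.Perm.inv_eq_iff_eq.mp h)
      simpa only [Function.update_of_ne hm, Function.update_of_ne this] using h m
    · rintro ⟨h1, h2, h3⟩ m
      by_cases hm : m = s
      · subst hm
        simpa only [Function.update_self, Function.update_of_ne hs] using h1
      by_cases hm' : m = c s
      · subst hm'
        simpa only [Function.update_of_ne hc, hcs, Function.update_self,
          h1] using h2
      · have : c⁻¹ m ≠ s := fun h => hm' (Equiv.Perm.inv_eq_iff_eq.mp h)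
        simpa only [Function.update_of_ne hm, Function.update_of_ne this] using h3 m hm hm'
  have split : (∀ m, i m = j ((Equiv.swap s (c s) * c)⁻¹ m)) ↔
      i s = j s ∧ i (c s) = j (c⁻¹ s) ∧ ∀ m, m ≠ s → m ≠ c s → i m = j (c⁻¹ m) := by
    simp only [_root_.mul_inv_rev, Equiv.swap_inv, Equiv.Perm.mul_apply]
    refine ⟨fun h => ⟨by simpa using h s, by simpa using h (c s), fun m hm hm' => ?_⟩,
      fun h m => ?_⟩
    · simpa [Equiv.swap_apply_of_ne_of_ne hm hm'] using h m
    by_cases hm : m = s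
    · subst hm
      simpa using h.1
    by_cases hm' : m = c s
    · subst hm'
      simpa using h.2.1
    · simpa [Equiv.swap_apply_of_ne_of_ne hm hm'] using h.2.2 m hm hm'
  simp only [depOn, Matrix.of_apply, Matrix.add_apply, Matrix.smul_apply, smul_eq_mul]
  congr 2
  simp only [Perm3, Matrix.of_apply, key, split, ite_and, Finset.sum_ite_eq', Finset.mem_univ,
    if_true]

theorem sum_perm_fin_three {A : Type*} [AddCommMonoid A] (f : Equiv.Perm (Fin 3) → A) :
    ∑ c, f c = f 1 + f (Equiv.swap 0 1) + f (Equiv.swap 0 2) + f (Equiv.swap 1 2)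
      + f (finRotate 3) + f (finRotate 3)⁻¹ := by
  have h : (Finset.univ : Finset (Equiv.Perm (Fin 3))) =
      {1, Equiv.swap 0 1, Equiv.swap 0 2, Equiv.swap 1 2, finRotate 3, (finRotate 3)⁻¹} := by
    decide
  rw [h, Finset.sum_insert (by decide), Finset.sum_insert (by decide),
    Finset.sum_insert (by decide), Finset.sum_insert (by decide), Finset.sum_insert (by decide),
    Finset.sum_singleton]
  simp only [add_assoc]

theorem depOn_one_Perm3 {d : ℕ} (hd : d ≠ 0) (δ : ℝ) :
    depOn d δ 1 (Perm3 d 1) = Perm3 d 1 ∧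
    depOn d δ 1 (Perm3 d (Equiv.swap 0 1)) =
      (1 - (δ : ℂ)) • Perm3 d (Equiv.swap 0 1) + ((δ : ℂ) / d) • Perm3 d 1 ∧
    depOn d δ 1 (Perm3 d (Equiv.swap 0 2)) = Perm3 d (Equiv.swap 0 2) ∧
    depOn d δ 1 (Perm3 d (Equiv.swap 1 2)) =
      (1 - (δ : ℂ)) • Perm3 d (Equiv.swap 1 2) + ((δ : ℂ) / d) • Perm3 d 1 ∧
    depOn d δ 1 (Perm3 d (finRotate 3)) =
      (1 - (δ : ℂ)) • Perm3 d (finRotate 3) + ((δ : ℂ) / d) • Perm3 d (Equiv.swap 0 2) ∧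
    depOn d δ 1 (Perm3 d (finRotate 3)⁻¹) =
      (1 - (δ : ℂ)) • Perm3 d (finRotate 3)⁻¹ + ((δ : ℂ) / d) • Perm3 d (Equiv.swap 0 2) := by
  refine ⟨depOn_Perm3_of_fixed hd δ (by decide), ?_, depOn_Perm3_of_fixed hd δ (by decide),
    ?_, ?_, ?_⟩ <;>
  · rw [depOn_Perm3_of_moved d δ (by decide)]
    congr 3
    decide

theorem depOn_zero_Perm3 {d : ℕ} (hd : d ≠ 0) (δ : ℝ) :
    depOn d δ 0 (Perm3 d 1) = Perm3 d 1 ∧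
    depOn d δ 0 (Perm3 d (Equiv.swap 0 1)) =
      (1 - (δ : ℂ)) • Perm3 d (Equiv.swap 0 1) + ((δ : ℂ) / d) • Perm3 d 1 ∧
    depOn d δ 0 (Perm3 d (Equiv.swap 0 2)) =
      (1 - (δ : ℂ)) • Perm3 d (Equiv.swap 0 2) + ((δ : ℂ) / d) • Perm3 d 1 ∧
    depOn d δ 0 (Perm3 d (Equiv.swap 1 2)) = Perm3 d (Equiv.swap 1 2) ∧
    depOn d δ 0 (Perm3 d (finRotate 3)) =
      (1 - (δ : ℂ)) • Perm3 d (finRotate 3) + ((δ : ℂ) / d) • Perm3 d (Equiv.swap 1 2) ∧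
    depOn d δ 0 (Perm3 d (finRotate 3)⁻¹) =
      (1 - (δ : ℂ)) • Perm3 d (finRotate 3)⁻¹ + ((δ : ℂ) / d) • Perm3 d (Equiv.swap 1 2) := by
  refine ⟨depOn_Perm3_of_fixed hd δ (by decide), ?_, ?_, depOn_Perm3_of_fixed hd δ (by decide),
    ?_, ?_⟩ <;>
  · rw [depOn_Perm3_of_moved d δ (by decide)]
    congr 3
    decide

theorem pt3_one (d : ℕ) : pt3 d 1 = 1 := by
  ext i j
  simp only [pt3, Matrix.of_apply, Matrix.one_apply, funext_iff, Fin.forall_fin_succ]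
  simp [Function.update, eq_comm]

theorem Dnd_two_cast (d : ℕ) : (Dnd 2 d : ℂ) = d * (d + 1) / 2 := by
  have : 2 + d - 1 = d + 1 := by omega
  rw [Dnd, this, Nat.cast_choose_two]
  push_cast
  ring

theorem Dnd_three_cast (d : ℕ) : (Dnd 3 d : ℂ) = d * (d + 1) * (d + 2) / 6 := by
  have h : 3 + d - 1 = d + 2 := by omega
  have hdesc := Nat.descFactorial_eq_factorial_mul_choose (d + 2) 3
  have hmul : (d + 2) * (d + 1) * d = 6 * (d + 2).choose 3 := by
    simp [Nat.descFactorial, Nat.factorial] at hdesc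
    rw [← hdesc]
    ring
  rw [Dnd, h, eq_div_iff (by norm_num)]
  have := congrArg (Nat.cast : ℕ → ℂ) hmul
  push_cast at this
  linear_combination -this

/-- Decomposition of λ₀·R^{T₃} − Q^{T₃} as a combination of partially transposed
permutation operators. -/
theorem lam0_R_sub_Q_pt3_decomposition
    (d : ℕ) (hd : 2 ≤ d) (δ L cI c12 c13 c123 : ℝ)
    (hL : L = 1 - ((d : ℝ) - 1) * δ / d)
    (hcI : cI = (L * ((d : ℝ) * (2 * δ - δ ^ 2)) - δ ^ 2) / (d : ℝ) ^ 3
        - (1 - δ) * δ / ((d : ℝ) * (Dnd 2 d : ℝ))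
        + L * (1 - δ) ^ 2 / (2 * (Dnd 2 d : ℝ))
        - (1 - δ) ^ 2 / (6 * (Dnd 3 d : ℝ)))
    (hc12 : c12 = L * (1 - δ) ^ 2 / (2 * (Dnd 2 d : ℝ))
        - (1 - δ) ^ 2 / (6 * (Dnd 3 d : ℝ)))
    (hc13 : c13 = -((1 - δ) ^ 2 / (6 * (Dnd 3 d : ℝ))
        + (1 - δ) * δ / (2 * (d : ℝ) * (Dnd 2 d : ℝ))))
    (hc123 : c123 = -(1 - δ) ^ 2 / (6 * (Dnd 3 d : ℝ))) :
    L • pt3 d (Rop d δ) - pt3 d (Qop d δ) =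
      cI • (1 : Matrix (Idx d) (Idx d) ℂ)
      + c12 • pt3 d (Perm3 d (Equiv.swap 0 1))
      + c13 • (pt3 d (Perm3 d (Equiv.swap 0 2)) + pt3 d (Perm3 d (Equiv.swap 1 2)))
      + c123 • (pt3 d (Perm3 d (finRotate 3)) + pt3 d (Perm3 d (finRotate 3)⁻¹)) := by
  have hd0 : d ≠ 0 := by omega
  obtain ⟨a1, a2, a3, a4, a5, a6⟩ := depOn_one_Perm3 hd0 δ
  obtain ⟨b1, b2, b3, b4, b5, b6⟩ := depOn_zero_Perm3 hd0 δ
  have hdC : (d : ℂ) ≠ 0 := Nat.cast_ne_zero.mpr hd0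
  have hdC1 : (d : ℂ) + 1 ≠ 0 := by exact_mod_cast Nat.succ_ne_zero d
  have hdC2 : (d : ℂ) + 2 ≠ 0 := by exact_mod_cast Nat.succ_ne_zero (d + 1)
  rw [← pt3_one d, ← Perm3_one d]
  simp only [Rop, Qop, projSym3, sum_perm_fin_three, ← Perm3_one d, depOn_add, depOn_smul,
    a1, a2, a3, a4, a5, a6, b1, b2, b3, b4, b5, b6]
  ext i j
  simp only [pt3, Matrix.of_apply, Matrix.add_apply, Matrix.sub_apply, Matrix.smul_apply,
    smul_eq_mul, Complex.real_smul]
  subst hcI hc12 hc13 hc123 hL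
  push_cast
  rw [Dnd_two_cast, Dnd_three_cast]
  generalize Perm3 d 1 _ _ = p1
  generalize Perm3 d (Equiv.swap 0 1) _ _ = p2
  generalize Perm3 d (Equiv.swap 0 2) _ _ = p3
  generalize Perm3 d (Equiv.swap 1 2) _ _ = p4
  generalize Perm3 d (finRotate 3) _ _ = p5
  generalize Perm3 d (finRotate 3)⁻¹ _ _ = p6
  field_simp
  ring
end
end
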